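/- Let g_k = e^{2u_k} g_euc be smooth conformal metrics on ℝ² with u_k = 0 outside D_2, u_k converging weakly to u₀ in W^{1,p}(D_2) for every p ∈ (1,2), and ∫_D |K(g_k)| dμ_{g_k} < ε₀; assume the measures K⁻(g_k) dμ_{g_k} converge weakly to a measure ν⁻ and the distance functions d_{g_k} converge uniformly on D × D to a function d₀. If u₀ = 0 and ν⁻ = 0, then d₀(0, x) = |x| for every x ∈ D, i.e. d₀ agrees with the Euclidean distance from the origin. -/

import Mathlib

open MeasureTheory Filter Metric
open scoped Topology ENNReal

noncomputable section

/-- The Laplacian of `u : ℂ → ℝ` (sum of the two pure second derivatives). -/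
def lap (u : ℂ → ℝ) (x : ℂ) : ℝ :=
  iteratedFDeriv ℝ 2 u x ![1, 1] + iteratedFDeriv ℝ 2 u x ![Complex.I, Complex.I]

/-- Gauss curvature of the conformal metric `e^{2u} g_euc`: `K = -e^{-2u} Δu`. -/
def gauss (u : ℂ → ℝ) (x : ℂ) : ℝ := -Real.exp (-(2 * u x)) * lap u x

/-- Area `μ(A, g)` of a set for the metric `g = e^{2u} g_euc`. -/
def confAreaE (u : ℂ → ℝ) (A : Set ℂ) : ℝ≥0∞ :=
  ∫⁻ x in A, ENNReal.ofReal (Real.exp (2 * u x))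

/-- Total curvature `∫_A |K(g)| dμ_g` of the metric `g = e^{2u} g_euc`. -/
def curvIntE (u : ℂ → ℝ) (A : Set ℂ) : ℝ≥0∞ :=
  ∫⁻ x in A, ENNReal.ofReal (|gauss u x| * Real.exp (2 * u x))

/-- `C¹` paths from `x` to `y` staying in `S`. -/
def PathsIn (S : Set ℂ) (x y : ℂ) : Set (ℝ → ℂ) :=
  {γ | γ 0 = x ∧ γ 1 = y ∧ (∀ t ∈ Set.Icc (0:ℝ) 1, γ t ∈ S) ∧ ContDiff ℝ 1 γ}

/-- Length of a path for the metric `e^{2u} g_euc`. -/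
def confLen (u : ℂ → ℝ) (γ : ℝ → ℂ) : ℝ :=
  ∫ t in (0:ℝ)..1, Real.exp (u (γ t)) * ‖deriv γ t‖

/-- Geodesic distance (within `S`) of the conformal metric `e^{2u} g_euc`. -/
def confDist (u : ℂ → ℝ) (S : Set ℂ) (x y : ℂ) : ℝ :=
  sInf (confLen u '' PathsIn S x y)

/-- Metric ball `B_r^g(z)` of the conformal metric (within `S`). -/
def confBall (u : ℂ → ℝ) (S : Set ℂ) (z : ℂ) (r : ℝ) : Set ℂ :=
  {x ∈ S | confDist u S z x < r}

/-- `‖f‖_{L^{2,∞}(Ω)} ≤ C`, i.e. `t·|{|f| > t}|^{1/2} ≤ C` for all `t > 0`. -/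
def wL2Bound (f : ℂ → ℝ) (Ω : Set ℂ) (C : ℝ) : Prop :=
  ∀ t : ℝ, 0 < t → t * (volume {x ∈ Ω | t < |f x|}).toReal ^ ((1:ℝ)/2) ≤ C

/-- The `W^{1,p}(Ω)` norm of a differentiable function (via its classical gradient). -/
def w1pNormE (u : ℂ → ℝ) (Ω : Set ℂ) (p : ℝ) : ℝ≥0∞ :=
  (∫⁻ x in Ω, ENNReal.ofReal (|u x| ^ p)) ^ (1/p)
    + (∫⁻ x in Ω, ENNReal.ofReal (‖fderiv ℝ u x‖ ^ p)) ^ (1/p)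

/-- Real dot product on `ℂ = ℝ²`. -/
def dotC (a b : ℂ) : ℝ := a.re * b.re + a.im * b.im

/-- `V` is the distributional (weak) gradient of `u` on `Ω`. -/
def IsWeakGradOn (Ω : Set ℂ) (u : ℂ → ℝ) (V : ℂ → ℂ) : Prop :=
  ∀ φ : ℂ → ℝ, ContDiff ℝ (⊤ : ℕ∞) φ → HasCompactSupport φ → tsupport φ ⊆ Ω →
    ∀ w : ℂ, ∫ x in Ω, u x * fderiv ℝ φ x w = -∫ x in Ω, dotC (V x) w * φ x

/-- `v k → u` weakly in `W^{1,p}(Ω)`: uniformly bounded `W^{1,p}` norms together with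
convergence, tested against smooth compactly supported functions, of the functions and of
their weak gradients. -/
def WeakW1pLim (Ω : Set ℂ) (p : ℝ) (v : ℕ → ℂ → ℝ) (u : ℂ → ℝ) : Prop :=
  ∃ V : ℕ → ℂ → ℂ,
    (∀ k, IsWeakGradOn Ω (v k) (V k)) ∧
    (∃ C : ℝ, ∀ k, (∫ x in Ω, |v k x| ^ p) ^ (1/p)
        + (∫ x in Ω, ‖V k x‖ ^ p) ^ (1/p) ≤ C) ∧
    (∀ φ : ℂ → ℝ, ContDiff ℝ (⊤ : ℕ∞) φ → HasCompactSupport φ → tsupport φ ⊆ Ω →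
      Tendsto (fun k => ∫ x in Ω, v k x * φ x) atTop (𝓝 (∫ x in Ω, u x * φ x)) ∧
      ∀ w : ℂ, Tendsto (fun k => ∫ x in Ω, dotC (V k x) w * φ x) atTop
        (𝓝 (-∫ x in Ω, u x * fderiv ℝ φ x w)))

/-- Mean value of `φ` on a set. -/
def avgOn (φ : ℂ → ℝ) (A : Set ℂ) : ℝ := (volume A).toReal⁻¹ * ∫ x in A, φ x

/-- Mean oscillation of `φ` on the disk `D_t(x₀)`. -/
def meanOsc (φ : ℂ → ℝ) (x₀ : ℂ) (t : ℝ) : ℝ :=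
  avgOn (fun x => |φ x - avgOn φ (ball x₀ t)|) (ball x₀ t)

/-- The John–Nirenberg radius `ρ(φ, x₀, Ω, λ)`. -/
def jnRad (φ : ℂ → ℝ) (x₀ : ℂ) (Ω : Set ℂ) (lam : ℝ) : ℝ :=
  sSup {r : ℝ | 0 ≤ r ∧ ∀ t : ℝ, 0 < t → t < r → ball x₀ t ⊆ Ω ∧ meanOsc φ x₀ t ≤ lam}

/-- Mean value of `u` along the circle `∂D_r(0)`. -/
def circMean (u : ℂ → ℝ) (r : ℝ) : ℝ :=
  (2 * Real.pi)⁻¹ * ∫ θ in (0:ℝ)..(2 * Real.pi), u ((r : ℂ) * Complex.exp ((θ : ℂ) * Complex.I))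

/-- Completeness of the conformal metric `e^{2v} g_euc` on all of `ℂ`. -/
def ConfComplete (v : ℂ → ℝ) : Prop :=
  ∀ x : ℕ → ℂ,
    (∀ ε : ℝ, 0 < ε → ∃ N : ℕ, ∀ m ≥ N, ∀ n ≥ N, confDist v Set.univ (x m) (x n) < ε) →
    ∃ l : ℂ, Tendsto (fun n => confDist v Set.univ (x n) l) atTop (𝓝 0)

/-- `(D, g_k)` extends to a complete conformal surface with total curvature at most `Λ`. -/
def ExtendsComplete (u : ℂ → ℝ) (Λ : ℝ) : Prop :=
  ∃ v : ℂ → ℝ, ContDiff ℝ (⊤ : ℕ∞) v ∧ Set.EqOn v u (ball (0:ℂ) 1) ∧ ConfComplete v ∧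
    curvIntE v Set.univ ≤ ENNReal.ofReal Λ

/-- Gromov–Hausdorff convergence of `(S, dk k)` to `(S, d)`, phrased through
correspondences of small distortion. -/
def GHTendsto (S : Set ℂ) (dk : ℕ → ℂ → ℂ → ℝ) (d : ℂ → ℂ → ℝ) : Prop :=
  ∀ ε : ℝ, 0 < ε → ∀ᶠ k in atTop, ∃ R : Set (ℂ × ℂ),
    (∀ p ∈ R, p.1 ∈ S ∧ p.2 ∈ S) ∧
    (∀ x ∈ S, ∃ y ∈ S, (x, y) ∈ R) ∧
    (∀ y ∈ S, ∃ x ∈ S, (x, y) ∈ R) ∧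
    (∀ p ∈ R, ∀ q ∈ R, |dk k p.1 q.1 - d p.2 q.2| < ε)

/-- `−Δu = f` on `Ω` in the sense of distributions. -/
def DistribLaplaceEq (Ω : Set ℂ) (u f : ℂ → ℝ) : Prop :=
  ∀ φ : ℂ → ℝ, ContDiff ℝ (⊤ : ℕ∞) φ → HasCompactSupport φ → tsupport φ ⊆ Ω →
    -∫ x in Ω, u x * lap φ x = ∫ x in Ω, f x * φ x

/-- Radial bump functions used for the local representation formula. -/
theorem aux_bump : ∃ (ψ P : ℂ → ℝ) (C : ℝ), 0 < C ∧ ContDiff ℝ (⊤ : ℕ∞) ψ ∧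
    HasCompactSupport ψ ∧ (∀ z, 1 < ‖z‖ → ψ z = 0) ∧ ContDiff ℝ (⊤ : ℕ∞) P ∧
    HasCompactSupport P ∧ (∀ z, 0 ≤ P z) ∧ (∀ z, P z ≤ C) ∧ (∀ z, 1 < ‖z‖ → P z = 0) ∧
    (∀ z w, fderiv ℝ P z w = -ψ z * dotC z w) ∧ ∫ z, ψ z = 1 := by
  set Q : ℂ → ℝ := fun z => 1 - (z.re ^ 2 + z.im ^ 2) with hQ
  set ψ₀ : ℂ → ℝ := fun z => 2 * deriv expNegInvGlue (Q z) with hψ₀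
  set P₀ : ℂ → ℝ := fun z => expNegInvGlue (Q z) with hP₀
  have hre : ContDiff ℝ (⊤ : ℕ∞) (fun z : ℂ => z.re) := Complex.reCLM.contDiff
  have him : ContDiff ℝ (⊤ : ℕ∞) (fun z : ℂ => z.im) := Complex.imCLM.contDiff
  have hQs : ContDiff ℝ (⊤ : ℕ∞) Q := contDiff_const.sub ((hre.pow 2).add (him.pow 2))
  have hE : ContDiff ℝ (⊤ : ℕ∞) expNegInvGlue := expNegInvGlue.contDiff
  have hE' : ContDiff ℝ (⊤ : ℕ∞) (deriv expNegInvGlue) :=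
    (contDiff_infty_iff_deriv.1 hE).2
  have hψs : ContDiff ℝ (⊤ : ℕ∞) ψ₀ := contDiff_const.mul (hE'.comp hQs)
  have hPs : ContDiff ℝ (⊤ : ℕ∞) P₀ := hE.comp hQs
  have hQneg : ∀ z : ℂ, 1 < ‖z‖ → Q z < 0 := by
    intro z hz
    have h1 : ‖z‖ ^ 2 = z.re ^ 2 + z.im ^ 2 := by
      rw [Complex.sq_norm, Complex.normSq_apply]; ring
    simp only [hQ]
    nlinarith
  have hP0 : ∀ z, 1 < ‖z‖ → P₀ z = 0 := fun z hz =>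
    expNegInvGlue.zero_of_nonpos (hQneg z hz).le
  have hψ0 : ∀ z, 1 < ‖z‖ → ψ₀ z = 0 := by
    intro z hz
    have : expNegInvGlue =ᶠ[𝓝 (Q z)] fun _ => 0 := by
      filter_upwards [Iio_mem_nhds (hQneg z hz)] with s hs
      exact expNegInvGlue.zero_of_nonpos (le_of_lt hs)
    simp only [hψ₀]
    rw [this.deriv_eq]
    simp
  have hcs : ∀ f : ℂ → ℝ, (∀ z, 1 < ‖z‖ → f z = 0) → HasCompactSupport f := by
    intro f hf
    refine HasCompactSupport.intro (isCompact_closedBall (0:ℂ) 1) ?_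
    intro z hz
    apply hf
    simpa using hz
  have hfd : ∀ z w, fderiv ℝ P₀ z w = -ψ₀ z * dotC z w := by
    intro z w
    have h1 : HasFDerivAt (fun z : ℂ => z.re) Complex.reCLM z := Complex.reCLM.hasFDerivAt
    have h2 : HasFDerivAt (fun z : ℂ => z.im) Complex.imCLM z := Complex.imCLM.hasFDerivAt
    have h3 := ((h1.pow 2).add (h2.pow 2)).const_sub 1
    have h4 : HasDerivAt expNegInvGlue (deriv expNegInvGlue (Q z)) (Q z) :=
      (hE.differentiable (by simp) (Q z)).hasDerivAt
    have h5 := h4.comp_hasFDerivAt z h3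
    have h6 : fderiv ℝ P₀ z = _ := h5.fderiv
    rw [h6]
    simp [hψ₀, dotC]
    ring
  have hψnn : ∀ z, 0 ≤ ψ₀ z := fun z => by
    have := expNegInvGlue.monotone.deriv_nonneg (x := Q z)
    simp only [hψ₀]; positivity
  have hne : ∃ z, ψ₀ z ≠ 0 := by
    by_contra hcon
    push Not at hcon
    have h0 : ∀ z, fderiv ℝ P₀ z = 0 := by
      intro z; ext w; simp [hfd, hcon]
    have := is_const_of_fderiv_eq_zero (hPs.differentiable (by simp)) h0 0 2
    rw [hP0 2 (by simp)] at this
    have h2 : 0 < P₀ 0 := expNegInvGlue.pos_of_pos (by simp [hQ])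
    linarith
  obtain ⟨z₀, hz₀⟩ := hne
  have hI : 0 < ∫ z, ψ₀ z :=
    hψs.continuous.integral_pos_of_hasCompactSupport_nonneg_nonzero (hcs _ hψ0)
      (fun z => hψnn z) hz₀
  set I := ∫ z, ψ₀ z with hIdef
  have hE1 : ∀ s : ℝ, expNegInvGlue s ≤ 1 := by
    intro s
    unfold expNegInvGlue
    split_ifs with h
    · simp
    · rw [Real.exp_le_one_iff]; push Not at h; simp [h.le]
  refine ⟨fun z => I⁻¹ * ψ₀ z, fun z => I⁻¹ * P₀ z, I⁻¹, inv_pos.2 hI, contDiff_const.mul hψs,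
    hcs _ ?_, ?_, contDiff_const.mul hPs, hcs _ ?_, ?_, ?_, ?_, ?_, ?_⟩
  · intro z hz; simp [hψ0 z hz]
  · intro z hz; simp [hψ0 z hz]
  · intro z hz; simp [hP0 z hz]
  · intro z; have := expNegInvGlue.nonneg (Q z); simp only [hP₀]; positivity
  · intro z
    have h := hE1 (Q z)
    calc I⁻¹ * P₀ z ≤ I⁻¹ * 1 := by gcongr
      _ = I⁻¹ := mul_one _
  · intro z hz; simp [hP0 z hz]
  · intro z w
    rw [fderiv_const_mul (hPs.differentiable (by simp) z)]
    simp [hfd]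
    ring
  · rw [integral_const_mul, ← hIdef]
    field_simp

theorem aux_lap_eq {u : ℂ → ℝ} (hu : ContDiff ℝ (⊤ : ℕ∞) u) (x : ℂ) :
    lap u x = fderiv ℝ (fun y => fderiv ℝ u y 1) x 1
      + fderiv ℝ (fun y => fderiv ℝ u y Complex.I) x Complex.I := by
  have hd : DifferentiableAt ℝ (fderiv ℝ u) x :=
    ((contDiff_infty_iff_fderiv.1 hu).2.differentiable (by simp)) x
  unfold lap
  rw [iteratedFDeriv_two_apply, iteratedFDeriv_two_apply]
  have key : ∀ v : ℂ, fderiv ℝ (fun y => fderiv ℝ u y v) x v = fderiv ℝ (fderiv ℝ u) x v v := by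
    intro v
    rw [fderiv_clm_apply hd (differentiableAt_const v)]
    simp
  rw [key, key]
  simp

theorem aux_smooth_dir {u : ℂ → ℝ} (hu : ContDiff ℝ (⊤ : ℕ∞) u) (v : ℂ) :
    ContDiff ℝ (⊤ : ℕ∞) (fun y => fderiv ℝ u y v) :=
  (contDiff_infty_iff_fderiv.1 hu).2.clm_apply contDiff_const

theorem aux_lap_smooth {u : ℂ → ℝ} (hu : ContDiff ℝ (⊤ : ℕ∞) u) :
    ContDiff ℝ (⊤ : ℕ∞) (lap u) := by
  have : lap u = fun x => fderiv ℝ (fun y => fderiv ℝ u y 1) x 1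
      + fderiv ℝ (fun y => fderiv ℝ u y Complex.I) x Complex.I := by
    funext x; exact aux_lap_eq hu x
  rw [this]
  exact (aux_smooth_dir (aux_smooth_dir hu 1) 1).add
    (aux_smooth_dir (aux_smooth_dir hu Complex.I) Complex.I)

theorem aux_lap_supp {u : ℂ → ℝ} (hu : ContDiff ℝ (⊤ : ℕ∞) u) :
    tsupport (lap u) ⊆ tsupport u := by
  have key : ∀ (w : ℂ → ℝ) (v : ℂ), tsupport (fun y => fderiv ℝ w y v) ⊆ tsupport w := by
    intro w v
    exact tsupport_fderiv_apply_subset ℝ v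
  have : lap u = (fun x => fderiv ℝ (fun y => fderiv ℝ u y 1) x 1)
      + (fun x => fderiv ℝ (fun y => fderiv ℝ u y Complex.I) x Complex.I) := by
    funext x; exact aux_lap_eq hu x
  rw [this]
  refine (tsupport_add _ _).trans (Set.union_subset ?_ ?_)
  · exact (key _ _).trans (key _ _)
  · exact (key _ _).trans (key _ _)

theorem aux_lap_neg {u : ℂ → ℝ} (x : ℂ) :
    lap (fun y => -u y) x = -lap u x := by
  have : (fun y => -u y) = -u := rfl
  unfold lap
  rw [this, iteratedFDeriv_neg_apply]
  simp
  ring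

theorem aux_ibp {f g : ℂ → ℝ} (hf : ContDiff ℝ (⊤ : ℕ∞) f) (hg : ContDiff ℝ (⊤ : ℕ∞) g)
    (hc : HasCompactSupport f) (v : ℂ) :
    ∫ x, f x * fderiv ℝ g x v = -∫ x, fderiv ℝ f x v * g x := by
  have hfv := (aux_smooth_dir hf v).continuous
  have hgv := (aux_smooth_dir hg v).continuous
  refine integral_mul_fderiv_eq_neg_fderiv_mul_of_integrable ?_ ?_ ?_ ?_ ?_
  · exact (hfv.mul hg.continuous).integrable_of_hasCompactSupport
      ((hc.fderiv_apply (𝕜 := ℝ) v).mul_right)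
  · exact (hf.continuous.mul hgv).integrable_of_hasCompactSupport hc.mul_right
  · exact (hf.continuous.mul hg.continuous).integrable_of_hasCompactSupport hc.mul_right
  · exact fun x _ => hf.differentiable (by simp) x
  · exact fun x _ => hg.differentiable (by simp) x

theorem aux_green {f g : ℂ → ℝ} (hf : ContDiff ℝ (⊤ : ℕ∞) f) (hg : ContDiff ℝ (⊤ : ℕ∞) g)
    (hc : HasCompactSupport f) :
    ∫ x, f x * lap g x = ∫ x, lap f x * g x := by
  have key : ∀ v : ℂ, ∫ x, f x * fderiv ℝ (fun y => fderiv ℝ g y v) x v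
      = ∫ x, fderiv ℝ (fun y => fderiv ℝ f y v) x v * g x := by
    intro v
    rw [aux_ibp hf (aux_smooth_dir hg v) hc v,
      aux_ibp (aux_smooth_dir hf v) hg (hc.fderiv_apply (𝕜 := ℝ) v) v]
    simp
  have hi1 : ∀ v : ℂ, Integrable (fun x => f x * fderiv ℝ (fun y => fderiv ℝ g y v) x v) :=
    fun v => (hf.continuous.mul
      (aux_smooth_dir (aux_smooth_dir hg v) v).continuous).integrable_of_hasCompactSupport
      hc.mul_right
  have hi2 : ∀ v : ℂ, Integrable (fun x => fderiv ℝ (fun y => fderiv ℝ f y v) x v * g x) :=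
    fun v => ((aux_smooth_dir (aux_smooth_dir hf v) v).continuous.mul
      hg.continuous).integrable_of_hasCompactSupport
      (((hc.fderiv_apply (𝕜 := ℝ) v).fderiv_apply (𝕜 := ℝ) v).mul_right)
  simp_rw [aux_lap_eq hf, aux_lap_eq hg, mul_add, add_mul]
  rw [integral_add (hi1 _) (hi1 _), integral_add (hi2 _) (hi2 _), key, key]

theorem aux_rep_cont {P h : ℂ → ℝ} (hP : Continuous P) (hPc : HasCompactSupport P)
    (hh : Continuous h) (hhc : HasCompactSupport h) (x : ℂ) :
    Continuous (fun t : ℝ => ∫ z, P z * h (x + t • z)) := by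
  obtain ⟨M, hM⟩ := hhc.exists_bound_of_continuous hh
  refine continuous_of_dominated (bound := fun z => ‖P z‖ * M) ?_ ?_ ?_ ?_
  · intro t
    exact (by fun_prop : Continuous (fun z : ℂ => P z * h (x + t • z))).aestronglyMeasurable
  · intro t
    refine Eventually.of_forall fun z => ?_
    rw [norm_mul]
    gcongr
    exact hM _
  · exact ((hP.integrable_of_hasCompactSupport hPc).norm).mul_const M
  · refine Eventually.of_forall fun z => ?_
    fun_prop

theorem aux_rep {ψ P : ℂ → ℝ} (hψ : ContDiff ℝ (⊤ : ℕ∞) ψ)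
    (hψc : HasCompactSupport ψ) (hP : ContDiff ℝ (⊤ : ℕ∞) P) (hPc : HasCompactSupport P)
    (hfd : ∀ z w, fderiv ℝ P z w = -ψ z * dotC z w) (hmass : ∫ z, ψ z = 1)
    {u : ℂ → ℝ} (hu : ContDiff ℝ (⊤ : ℕ∞) u) (huc : HasCompactSupport u) (x : ℂ) (δ : ℝ) :
    u x = (∫ z, ψ z * u (x + δ • z)) - ∫ t in (0:ℝ)..δ, t * ∫ z, P z * lap u (x + t • z) := by
  set S : ℝ → ℝ := fun t => ∫ z, ψ z * u (x + t • z) with hS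
  have hdu : Continuous (fderiv ℝ u) := hu.continuous_fderiv (by simp)
  have hψcont := hψ.continuous
  have hucont := hu.continuous
  obtain ⟨M, hM⟩ := (huc.fderiv (𝕜 := ℝ)).exists_bound_of_continuous hdu
  have hinner : ∀ (t : ℝ) (z : ℂ), HasDerivAt (fun t : ℝ => ψ z * u (x + t • z))
      (ψ z * fderiv ℝ u (x + t • z) z) t := by
    intro t z
    have h1 : HasDerivAt (fun t : ℝ => x + t • z) z t := by
      simpa using ((hasDerivAt_id t).smul_const z).const_add x
    have h2 := (hu.differentiable (by simp) (x + t • z)).hasFDerivAt.comp_hasDerivAt t h1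
    exact h2.const_mul (ψ z)
  have hder : ∀ t, HasDerivAt S (∫ z, ψ z * fderiv ℝ u (x + t • z) z) t := by
    intro t
    refine (hasDerivAt_integral_of_dominated_loc_of_deriv_le (s := Set.univ)
      (F := fun (t : ℝ) (z : ℂ) => ψ z * u (x + t • z))
      (F' := fun (t : ℝ) (z : ℂ) => ψ z * fderiv ℝ u (x + t • z) z)
      (bound := fun z => ‖ψ z‖ * (M * ‖z‖)) univ_mem ?_ ?_ ?_ ?_ ?_ ?_).2
    · refine Eventually.of_forall fun s => ?_
      exact (by fun_prop : Continuous (fun z : ℂ => ψ z * u (x + s • z))).aestronglyMeasurable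
    · exact (by fun_prop : Continuous
        (fun z : ℂ => ψ z * u (x + t • z))).integrable_of_hasCompactSupport hψc.mul_right
    · exact (by fun_prop : Continuous
        (fun z : ℂ => ψ z * fderiv ℝ u (x + t • z) z)).aestronglyMeasurable
    · refine Eventually.of_forall fun z s _ => ?_
      rw [norm_mul]
      gcongr
      exact ((fderiv ℝ u (x + s • z)).le_opNorm z).trans (by gcongr; exact hM _)
    · exact (by fun_prop : Continuous
        (fun z : ℂ => ‖ψ z‖ * (M * ‖z‖))).integrable_of_hasCompactSupport hψc.norm.mul_right
    · exact Eventually.of_forall fun z s _ => hinner s z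
  have hval : ∀ t, ∫ z, ψ z * fderiv ℝ u (x + t • z) z
      = t * ∫ z, P z * lap u (x + t • z) := by
    intro t
    have haff : ContDiff ℝ (⊤ : ℕ∞) (fun z : ℂ => x + t • z) :=
      contDiff_const.add (contDiff_id.const_smul t)
    have hq : ∀ v : ℂ, ContDiff ℝ (⊤ : ℕ∞) (fun z : ℂ => fderiv ℝ u (x + t • z) v) :=
      fun v => (aux_smooth_dir hu v).comp haff
    have hqd : ∀ v z : ℂ, fderiv ℝ (fun z : ℂ => fderiv ℝ u (x + t • z) v) z v
        = t * fderiv ℝ (fun y => fderiv ℝ u y v) (x + t • z) v := by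
      intro v z
      have h1 : HasFDerivAt (fun z : ℂ => x + t • z) (t • ContinuousLinearMap.id ℝ ℂ) z :=
        ((hasFDerivAt_id z).const_smul t).const_add x
      have h2 := ((aux_smooth_dir hu v).differentiable (by simp)
        (x + t • z)).hasFDerivAt.comp z h1
      have h3 : fderiv ℝ (fun z : ℂ => fderiv ℝ u (x + t • z) v) z = _ := h2.fderiv
      rw [h3]
      simp
    have hib : ∀ v : ℂ, ∫ z, P z * (t * fderiv ℝ (fun y => fderiv ℝ u y v) (x + t • z) v)
        = ∫ z, ψ z * dotC z v * fderiv ℝ u (x + t • z) v := by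
      intro v
      have := aux_ibp hP (hq v) hPc v
      simp_rw [hqd, hfd] at this
      rw [this, ← integral_neg]
      congr 1; funext z; ring
    have hi1 : ∀ v : ℂ, Integrable
        (fun z => P z * (t * fderiv ℝ (fun y => fderiv ℝ u y v) (x + t • z) v)) := by
      intro v
      have h0 := (aux_smooth_dir (aux_smooth_dir hu v) v).continuous
      have h1 := h0.comp haff.continuous
      exact (hP.continuous.mul (continuous_const.mul h1)).integrable_of_hasCompactSupport
        hPc.mul_right
    have hi2 : ∀ v : ℂ, Integrable
        (fun z => ψ z * dotC z v * fderiv ℝ u (x + t • z) v) := by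
      intro v
      have hdc : Continuous (fun z : ℂ => dotC z v) := by unfold dotC; fun_prop
      exact (by fun_prop : Continuous (fun z => ψ z * dotC z v * fderiv ℝ u (x + t • z) v)
        ).integrable_of_hasCompactSupport (hψc.mul_right.mul_right)
    rw [← integral_const_mul]
    calc ∫ z, ψ z * fderiv ℝ u (x + t • z) z
        = ∫ z, (ψ z * dotC z 1 * fderiv ℝ u (x + t • z) 1
          + ψ z * dotC z Complex.I * fderiv ℝ u (x + t • z) Complex.I) := by
          congr 1; funext z
          have hz : z = z.re • (1:ℂ) + z.im • Complex.I := by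
            simp [Complex.re_add_im]
          have : fderiv ℝ u (x + t • z) z = z.re * fderiv ℝ u (x + t • z) 1
              + z.im * fderiv ℝ u (x + t • z) Complex.I := by
            conv_lhs => rw [show fderiv ℝ u (x + t • z) z
              = fderiv ℝ u (x + t • z) (z.re • (1:ℂ) + z.im • Complex.I) from by rw [← hz]]
            rw [map_add, map_smul, map_smul]; simp
          rw [this]; simp [dotC]; ring
      _ = ∫ z, t * (P z * lap u (x + t • z)) := by
          rw [integral_add (hi2 _) (hi2 _), ← hib, ← hib, ← integral_add (hi1 _) (hi1 _)]
          congr 1; funext z; rw [aux_lap_eq hu]; ring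
  have hlapc : HasCompactSupport (lap u) := huc.of_isClosed_subset (isClosed_tsupport _)
    (aux_lap_supp hu)
  have hcont := aux_rep_cont hP.continuous hPc (aux_lap_smooth hu).continuous hlapc x
  have hftc : ∫ t in (0:ℝ)..δ, t * ∫ z, P z * lap u (x + t • z) = S δ - S 0 := by
    refine intervalIntegral.integral_eq_sub_of_hasDerivAt (fun t _ => ?_) ?_
    · rw [← hval t]; exact hder t
    · exact (continuous_id.mul hcont).intervalIntegrable _ _
  rw [hftc]
  have : S 0 = u x := by
    simp only [hS, zero_smul, add_zero]
    rw [integral_mul_const, hmass, one_mul]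
  rw [this]; ring

theorem aux_ofReal_int {α : Type*} [MeasurableSpace α] (μ : Measure α) (f : α → ℝ) :
    ENNReal.ofReal (∫ x, f x ∂μ) ≤ ∫⁻ x, ENNReal.ofReal (f x) ∂μ := by
  by_cases hf : Integrable f μ
  · have h1 : ∫ x, f x ∂μ ≤ ∫ x, max (f x) 0 ∂μ :=
      integral_mono hf hf.pos_part (fun x => le_max_left _ _)
    refine (ENNReal.ofReal_le_ofReal h1).trans ?_
    rw [ofReal_integral_eq_lintegral_ofReal hf.pos_part
      (Eventually.of_forall fun x => le_max_right _ _)]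
    refine lintegral_mono fun x => ?_
    simp
  · rw [integral_undef hf]; simp

theorem aux_scale (K : ℂ → ℝ≥0∞) (hK : Measurable K) (x : ℂ) {t : ℝ} (ht : 0 < t) :
    ∫⁻ z, K (x + t • z) = ENNReal.ofReal ((t ^ 2)⁻¹) * ∫⁻ y, K y := by
  have h1 : ∫⁻ z, K (x + t • z) = ∫⁻ y, K (x + y) ∂(Measure.map (fun z : ℂ => t • z) volume) := by
    rw [lintegral_map (by fun_prop) (by fun_prop)]
  rw [h1, Measure.map_addHaar_smul volume ht.ne', lintegral_smul_measure,
    lintegral_add_left_eq_self]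
  simp [Complex.finrank_real_complex]
  
theorem aux_log {s δ : ℝ} (hs : 0 < s) (hδ : δ ≤ 1) :
    ∫⁻ t in Set.Ioc 0 δ, (if s ≤ t then ENNReal.ofReal t⁻¹ else 0)
      ≤ ENNReal.ofReal (-Real.log s) := by
  have h1 : ∫⁻ t in Set.Ioc 0 δ, (if s ≤ t then ENNReal.ofReal t⁻¹ else 0)
      = ∫⁻ t in Set.Icc s δ, ENNReal.ofReal t⁻¹ := by
    rw [← lintegral_indicator measurableSet_Ioc, ← lintegral_indicator measurableSet_Icc]
    congr 1; funext t
    by_cases h : s ≤ t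
    · have : 0 < t := hs.trans_le h
      by_cases h2 : t ≤ δ <;> simp [Set.indicator, h, h2, this]
    · simp [Set.indicator, h]
  rw [h1]
  rcases le_or_gt s δ with hsd | hsd
  · have hcont : ContinuousOn (fun t : ℝ => t⁻¹) (Set.Icc s δ) :=
      continuousOn_inv₀.mono (fun t ht => (hs.trans_le ht.1).ne')
    rw [← ofReal_integral_eq_lintegral_ofReal hcont.integrableOn_Icc]
    · apply ENNReal.ofReal_le_ofReal
      rw [integral_Icc_eq_integral_Ioc, ← intervalIntegral.integral_of_le hsd,
        integral_inv_of_pos hs (hs.trans_le hsd),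
        Real.log_div (hs.trans_le hsd).ne' hs.ne']
      have := Real.log_nonpos (hs.trans_le hsd).le hδ
      linarith
    · rw [EventuallyLE, ae_restrict_iff' measurableSet_Icc]
      exact Eventually.of_forall fun t ht => by
        have := hs.trans_le ht.1
        simp only [Pi.zero_apply]; positivity
  · rw [Set.Icc_eq_empty (by simpa using hsd)]; simp

theorem aux_kernel {P h : ℂ → ℝ} {C δ R : ℝ} (hC : 0 < C)
    (hP0 : ∀ z, 0 ≤ P z) (hPC : ∀ z, P z ≤ C) (hPs : ∀ z, 1 < ‖z‖ → P z = 0)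
    (hh : Continuous h) (hδ : 0 < δ) (hδ1 : δ ≤ 1) (x : ℂ) (hx : ‖x‖ + δ < R) :
    ENNReal.ofReal (∫ t in (0:ℝ)..δ, t * ∫ z, P z * h (x + t • z))
      ≤ ENNReal.ofReal C * ∫⁻ y in ball (0:ℂ) R,
        ENNReal.ofReal (h y) * ENNReal.ofReal (-Real.log |‖y‖ - ‖x‖|) := by
  set H : ℂ → ℝ≥0∞ := fun y => ENNReal.ofReal (h y) with hH
  have hHm : Measurable H := by fun_prop
  have hin : ∀ t ∈ Set.Ioc 0 δ, ENNReal.ofReal (t * ∫ z, P z * h (x + t • z))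
      ≤ ENNReal.ofReal C * ∫⁻ y in ball (0:ℂ) R,
        H y * (if |‖y‖ - ‖x‖| ≤ t then ENNReal.ofReal t⁻¹ else 0) := by
    intro t ht
    have ht0 : 0 < t := ht.1
    have hKm : Measurable ((closedBall x t).indicator H) :=
      hHm.indicator measurableSet_closedBall
    have h1 : ENNReal.ofReal (∫ z, P z * h (x + t • z))
        ≤ ∫⁻ z, ENNReal.ofReal C * (closedBall x t).indicator H (x + t • z) := by
      refine (aux_ofReal_int _ _).trans (lintegral_mono fun z => ?_)
      by_cases hz : 1 < ‖z‖
      · simp [hPs z hz]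
      · have hmem : x + t • z ∈ closedBall x t := by
          simp only [mem_closedBall, dist_self_add_left, norm_smul, Real.norm_eq_abs,
            abs_of_pos ht0]
          push Not at hz
          nlinarith
        rw [Set.indicator_of_mem hmem, ENNReal.ofReal_mul (hP0 z)]
        gcongr
        exact hPC z
    rw [ENNReal.ofReal_mul ht0.le]
    calc ENNReal.ofReal t * ENNReal.ofReal (∫ z, P z * h (x + t • z))
        ≤ ENNReal.ofReal t * (ENNReal.ofReal C *
          (ENNReal.ofReal ((t ^ 2)⁻¹) * ∫⁻ y, (closedBall x t).indicator H y)) := by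
          gcongr
          refine h1.trans ?_
          rw [lintegral_const_mul' _ _ ENNReal.ofReal_ne_top, aux_scale _ hKm x ht0]
      _ = ENNReal.ofReal C * (ENNReal.ofReal t⁻¹ * ∫⁻ y, (closedBall x t).indicator H y) := by
          have : ENNReal.ofReal t⁻¹ = ENNReal.ofReal t * ENNReal.ofReal ((t ^ 2)⁻¹) := by
            rw [← ENNReal.ofReal_mul ht0.le]
            congr 1; field_simp
          rw [this]; ring
      _ ≤ _ := by
          gcongr
          rw [← lintegral_const_mul _ hKm, ← lintegral_indicator measurableSet_ball]
          refine lintegral_mono fun y => ?_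
          by_cases hy : y ∈ closedBall x t
          · have hd : ‖y - x‖ ≤ t := by simpa [dist_eq_norm] using hy
            have hyR : y ∈ ball (0:ℂ) R := by
              have := norm_le_norm_add_norm_sub' y x
              have := ht.2
              simp only [mem_ball, dist_zero_right]; linarith
            have h3 : |‖y‖ - ‖x‖| ≤ t := (abs_norm_sub_norm_le y x).trans hd
            rw [Set.indicator_of_mem hy, Set.indicator_of_mem hyR, if_pos h3, mul_comm]
          · rw [Set.indicator_of_notMem hy]; simp
  have hmeas : Measurable (Function.uncurry fun (t : ℝ) (y : ℂ) =>
      H y * (if |‖y‖ - ‖x‖| ≤ t then ENNReal.ofReal t⁻¹ else 0)) := by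
    refine (hHm.comp measurable_snd).mul (Measurable.ite ?_ ?_ measurable_const)
    · exact measurableSet_le (by fun_prop) measurable_fst
    · fun_prop
  rw [intervalIntegral.integral_of_le hδ.le]
  refine (aux_ofReal_int _ _).trans ?_
  refine (setLIntegral_mono' measurableSet_Ioc hin).trans ?_
  rw [lintegral_const_mul' _ _ ENNReal.ofReal_ne_top, lintegral_lintegral_swap hmeas.aemeasurable]
  gcongr ENNReal.ofReal C * ?_
  have hsph : ∀ᵐ y : ℂ, y ∉ sphere (0:ℂ) ‖x‖ :=
    measure_eq_zero_iff_ae_notMem.1 (Measure.addHaar_sphere _ _ _)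
  refine lintegral_mono_ae (ae_restrict_of_ae ?_)
  filter_upwards [hsph] with y hy
  rw [lintegral_const_mul' _ _ ENNReal.ofReal_ne_top]
  gcongr
  refine aux_log ?_ hδ1
  rw [abs_pos, sub_ne_zero]
  simpa using hy

theorem aux_jensen {α : Type*} [MeasurableSpace α] (ν : Measure α) (hν : ν Set.univ ≤ 1)
    (g : α → ℝ) (hg : Measurable g) (hg0 : ∀ x, 0 ≤ g x) (c : ℝ)
    (hc : ENNReal.ofReal c ≤ ∫⁻ x, ENNReal.ofReal (g x) ∂ν) :
    ENNReal.ofReal (Real.exp c) ≤ 1 + ∫⁻ x, ENNReal.ofReal (Real.exp (g x)) ∂ν := by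
  rcases le_or_gt c 0 with hc0 | hc0
  · refine le_trans ?_ le_self_add
    rw [← ENNReal.ofReal_one]
    exact ENNReal.ofReal_le_ofReal (Real.exp_le_one_iff.2 hc0)
  set I := ∫⁻ x, ENNReal.ofReal (Real.exp (g x)) ∂ν with hI
  set G := ∫⁻ x, ENNReal.ofReal (g x) ∂ν with hG
  by_cases hIt : I = ⊤
  · simp [hIt]
  have hGI : G ≤ I := lintegral_mono fun x => ENNReal.ofReal_le_ofReal
    (by linarith [Real.add_one_le_exp (g x)])
  have hGt : G ≠ ⊤ := ne_top_of_le_ne_top hIt hGI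
  have hmt : ν Set.univ ≠ ⊤ := ne_top_of_le_ne_top ENNReal.one_ne_top hν
  set m := (ν Set.univ).toReal with hm
  have hm1 : m ≤ 1 := by
    have := ENNReal.toReal_mono ENNReal.one_ne_top hν
    simpa using this
  have hE : 0 < Real.exp c := Real.exp_pos c
  have hmain : ENNReal.ofReal (Real.exp c) * G + ENNReal.ofReal (Real.exp c) * ν Set.univ
      ≤ I + ENNReal.ofReal (c * Real.exp c) * ν Set.univ := by
    have h1 : ∫⁻ x, (ENNReal.ofReal (Real.exp c) * ENNReal.ofReal (g x)
        + ENNReal.ofReal (Real.exp c)) ∂ν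
        ≤ ∫⁻ x, (ENNReal.ofReal (Real.exp (g x)) + ENNReal.ofReal (c * Real.exp c)) ∂ν := by
      refine lintegral_mono fun x => ?_
      rw [← ENNReal.ofReal_mul hE.le, ← ENNReal.ofReal_add (by have := hg0 x; positivity) hE.le,
        ← ENNReal.ofReal_add (by positivity) (by positivity)]
      apply ENNReal.ofReal_le_ofReal
      have h2 := Real.add_one_le_exp (g x - c)
      have h3 : Real.exp (g x) = Real.exp c * Real.exp (g x - c) := by
        rw [← Real.exp_add]; congr 1; ring
      rw [h3]
      nlinarith
    rw [lintegral_add_right _ measurable_const, lintegral_add_right _ measurable_const,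
      lintegral_const_mul' _ _ ENNReal.ofReal_ne_top, lintegral_const, lintegral_const] at h1
    exact h1
  have hreal : Real.exp c * G.toReal + Real.exp c * m ≤ I.toReal + c * Real.exp c * m := by
    have := ENNReal.toReal_mono (by finiteness) hmain
    rw [ENNReal.toReal_add (by finiteness) (by finiteness),
      ENNReal.toReal_add (by finiteness) (by finiteness), ENNReal.toReal_mul, ENNReal.toReal_mul,
      ENNReal.toReal_mul, ENNReal.toReal_ofReal hE.le, ENNReal.toReal_ofReal (by positivity)]
      at this
    exact this
  have hcG : c ≤ G.toReal := (ENNReal.ofReal_le_iff_le_toReal hGt).1 hc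
  have h5 : Real.exp c * (1 - c) ≤ 1 := by
    have := Real.add_one_le_exp (-c)
    have h6 : Real.exp c * Real.exp (-c) = 1 := by rw [← Real.exp_add]; simp
    nlinarith
  have hfin : Real.exp c ≤ 1 + I.toReal := by
    have hm0 : 0 ≤ m := ENNReal.toReal_nonneg
    nlinarith [mul_le_mul_of_nonneg_left hcG hE.le, mul_le_mul_of_nonneg_right h5
      (sub_nonneg.2 hm1)]
  rw [ENNReal.ofReal_le_iff_le_toReal (by finiteness), ENNReal.toReal_add (by simp) hIt]
  simpa using hfin

theorem aux_point {ψ P : ℂ → ℝ} {C : ℝ} (hC : 0 < C) (hψ : ContDiff ℝ (⊤ : ℕ∞) ψ)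
    (hψc : HasCompactSupport ψ) (hP : ContDiff ℝ (⊤ : ℕ∞) P) (hPc : HasCompactSupport P)
    (hP0 : ∀ z, 0 ≤ P z) (hPC : ∀ z, P z ≤ C) (hPs : ∀ z, 1 < ‖z‖ → P z = 0)
    (hfd : ∀ z w, fderiv ℝ P z w = -ψ z * dotC z w) (hmass : ∫ z, ψ z = 1)
    {u : ℂ → ℝ} (hu : ContDiff ℝ (⊤ : ℕ∞) u) (huc : HasCompactSupport u) {x : ℂ} {δ R η : ℝ}
    (hδ : 0 < δ) (hδ1 : δ ≤ 1) (hx : ‖x‖ + δ < R)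
    (hη : ∫ z, ψ z * u (x + δ • z) ≤ η)
    (hm : ENNReal.ofReal (2 * C) * ∫⁻ y in ball (0:ℂ) R, ENNReal.ofReal (-lap u y) ≤ 1) :
    ENNReal.ofReal (Real.exp (u x - η)) ≤ 1 + ENNReal.ofReal (2 * C) *
      ∫⁻ y in ball (0:ℂ) R, ENNReal.ofReal (-lap u y) *
        ENNReal.ofReal (1 + |‖y‖ - ‖x‖| ^ (-(1/2) : ℝ)) := by
  have hlap := (aux_lap_smooth hu).continuous
  have hrep := aux_rep hψ hψc hP hPc hfd hmass hu huc x δ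
  have hker := aux_kernel (h := fun y => -lap u y) hC hP0 hPC hPs hlap.neg hδ hδ1 x hx
  set D : ℂ → ℝ≥0∞ := fun y => ENNReal.ofReal (2 * C) * ENNReal.ofReal (-lap u y) with hD
  have hDm : Measurable D := by
    have := hlap.measurable
    fun_prop
  set ν := (volume.restrict (ball (0:ℂ) R)).withDensity D with hνdef
  set g : ℂ → ℝ := fun y => max (-Real.log |‖y‖ - ‖x‖|) 0 / 2 with hg
  have hgm : Measurable g := by fun_prop
  have hlm : Measurable (fun y : ℂ => ENNReal.ofReal (-lap u y)) := by
    have := hlap.measurable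
    fun_prop
  have hν : ν Set.univ ≤ 1 := by
    rw [hνdef, withDensity_apply _ MeasurableSet.univ, Measure.restrict_univ, hD,
      lintegral_const_mul _ hlm]
    exact hm
  have key := aux_jensen ν hν g hgm (fun y => by simp only [hg]; positivity) (u x - η) ?_
  · refine key.trans ?_
    rw [hνdef, lintegral_withDensity_eq_lintegral_mul _ hDm (by fun_prop),
      ← lintegral_const_mul _ (by fun_prop)]
    gcongr 1 + ?_
    refine lintegral_mono fun y => ?_
    simp only [Pi.mul_apply, hD]
    rw [mul_assoc]
    gcongr
    simp only [hg]
    set s := |‖y‖ - ‖x‖| with hs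
    have hs0 : 0 ≤ s := abs_nonneg _
    have hp : 0 ≤ s ^ (-(1/2) : ℝ) := Real.rpow_nonneg hs0 _
    rcases hs0.eq_or_lt with h0 | h0
    · rw [← h0] at hp ⊢
      simp only [Real.log_zero, neg_zero, max_self, zero_div, Real.exp_zero]
      linarith
    · rcases le_total (-Real.log s) 0 with h1 | h1
      · rw [max_eq_right h1]; simp; exact_mod_cast (by simpa using hp)
      · rw [max_eq_left h1, Real.rpow_def_of_pos h0,
          show Real.log s * (-(1/2)) = -Real.log s / 2 by ring]
        linarith
  · have h1 : u x - η ≤ ∫ t in (0:ℝ)..δ, t * ∫ z, P z * -lap u (x + t • z) := by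
      have : ∫ t in (0:ℝ)..δ, t * ∫ z, P z * -lap u (x + t • z)
          = -∫ t in (0:ℝ)..δ, t * ∫ z, P z * lap u (x + t • z) := by
        rw [← intervalIntegral.integral_neg]
        congr 1; funext t
        simp_rw [mul_neg]
        rw [integral_neg]; ring
      rw [this]; linarith
    refine (ENNReal.ofReal_le_ofReal h1).trans (hker.trans (le_of_eq ?_))
    rw [hνdef, lintegral_withDensity_eq_lintegral_mul _ hDm (by fun_prop),
      ← lintegral_const_mul _ (by fun_prop)]
    congr 1; funext y
    simp only [Pi.mul_apply, hD, hg]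
    rw [mul_comm 2 C, ENNReal.ofReal_mul hC.le]
    have : ENNReal.ofReal (-Real.log |‖y‖ - ‖x‖|)
        = ENNReal.ofReal 2 * ENNReal.ofReal (max (-Real.log |‖y‖ - ‖x‖|) 0 / 2) := by
      rw [← ENNReal.ofReal_mul (by norm_num)]
      rw [mul_div_cancel₀ _ (by norm_num : (2:ℝ) ≠ 0)]
      simp
    rw [this]; ring

theorem aux_B : ∃ B : ℝ, 0 ≤ B ∧ ∀ ρ s : ℝ, 0 ≤ ρ → ρ ≤ 1 → s ≤ 1 →
    ∫⁻ r in Set.Ioc 0 s, ENNReal.ofReal (1 + |ρ - r| ^ (-(1/2) : ℝ)) ≤ ENNReal.ofReal B := by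
  have h01 : IntervalIntegrable (fun s : ℝ => |s| ^ (-(1/2) : ℝ)) volume 0 1 := by
    have := intervalIntegral.intervalIntegrable_rpow' (a := 0) (b := 1) (r := -(1/2)) (by norm_num)
    refine this.congr ?_
    intro t ht
    rw [Set.uIoc_of_le zero_le_one] at ht
    simp only [abs_of_pos ht.1]
  have h10 : IntervalIntegrable (fun s : ℝ => |s| ^ (-(1/2) : ℝ)) volume (-1) 0 := by
    have h2 := (IntervalIntegrable.iff_comp_neg (f := fun s : ℝ => |s| ^ (-(1/2) : ℝ))).1 h01
    simpa using h2.symm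
  have hfull : IntervalIntegrable (fun s : ℝ => 1 + |s| ^ (-(1/2) : ℝ)) volume (-1) 1 :=
    intervalIntegrable_const.add (h10.trans h01)
  rw [intervalIntegrable_iff_integrableOn_Icc_of_le (by norm_num)] at hfull
  refine ⟨∫ s in Set.Icc (-1:ℝ) 1, (1 + |s| ^ (-(1/2) : ℝ)), ?_, ?_⟩
  · exact integral_nonneg fun s => by
      have := Real.rpow_nonneg (abs_nonneg s) (-(1/2) : ℝ)
      simp only [Pi.zero_apply]; linarith
  · intro ρ s h0 h1 hs
    rw [ofReal_integral_eq_lintegral_ofReal hfull (Eventually.of_forall fun s => by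
      have := Real.rpow_nonneg (abs_nonneg s) (-(1/2) : ℝ)
      simp only [Pi.zero_apply]; linarith), ← lintegral_indicator measurableSet_Icc,
      ← lintegral_sub_left_eq_self (Set.indicator (Set.Icc (-1:ℝ) 1) _) ρ, ← lintegral_indicator measurableSet_Ioc]
    refine lintegral_mono fun r => ?_
    by_cases hr : r ∈ Set.Ioc 0 s
    · have : ρ - r ∈ Set.Icc (-1:ℝ) 1 := ⟨by linarith [hr.2], by linarith [hr.1]⟩
      rw [Set.indicator_of_mem hr, Set.indicator_of_mem this]
    · rw [Set.indicator_of_notMem hr]; simp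

theorem aux_integrated {h : ℂ → ℝ} (hh : Continuous h) {B c s R : ℝ} (hc : 0 ≤ c)
    (hB : ∀ ρ s : ℝ, 0 ≤ ρ → ρ ≤ 1 → s ≤ 1 →
      ∫⁻ r in Set.Ioc 0 s, ENNReal.ofReal (1 + |ρ - r| ^ (-(1/2) : ℝ)) ≤ ENNReal.ofReal B)
    (hs : s ≤ 1) (hR : R ≤ 1) :
    ∫⁻ r in Set.Ioc 0 s, ENNReal.ofReal c * ∫⁻ y in ball (0:ℂ) R, ENNReal.ofReal (h y) *
        ENNReal.ofReal (1 + |‖y‖ - r| ^ (-(1/2) : ℝ))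
      ≤ ENNReal.ofReal c * (ENNReal.ofReal B * ∫⁻ y in ball (0:ℂ) R, ENNReal.ofReal (h y)) := by
  have hmeas : Measurable (Function.uncurry fun (r : ℝ) (y : ℂ) =>
      ENNReal.ofReal (h y) * ENNReal.ofReal (1 + |‖y‖ - r| ^ (-(1/2) : ℝ))) := by
    have h1 : Measurable h := hh.measurable
    have h2 : Measurable (fun p : ℝ × ℂ => h p.2) := h1.comp measurable_snd
    unfold Function.uncurry
    fun_prop
  rw [lintegral_const_mul' _ _ ENNReal.ofReal_ne_top, lintegral_lintegral_swap hmeas.aemeasurable]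
  gcongr ENNReal.ofReal c * ?_
  rw [← lintegral_const_mul' _ _ ENNReal.ofReal_ne_top]
  refine setLIntegral_mono' measurableSet_ball fun y hy => ?_
  rw [lintegral_const_mul' _ _ ENNReal.ofReal_ne_top, mul_comm]
  gcongr
  have : ‖y‖ < R := by simpa using hy
  exact hB _ _ (norm_nonneg _) (by linarith) hs

theorem aux_F {u : ℂ → ℝ} (hu : Continuous u) : ∃ F : ℝ → ℝ, Continuous F ∧
    (∀ z : ℂ, F ‖z‖ ≤ Real.exp (u z)) ∧
    (∀ r : ℝ, 0 ≤ r → ∃ z : ℂ, ‖z‖ = r ∧ F r = Real.exp (u z)) := by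
  have hK : IsCompact (sphere (0:ℂ) 1) := isCompact_sphere 0 1
  refine ⟨fun r => sInf ((fun z : ℂ => Real.exp (u (r • z))) '' sphere (0:ℂ) 1), ?_, ?_, ?_⟩
  · refine hK.continuous_sInf (f := fun (r : ℝ) (z : ℂ) => Real.exp (u (r • z))) ?_
    exact (by fun_prop : Continuous (fun p : ℝ × ℂ => Real.exp (u (p.1 • p.2))))
  · intro z
    refine csInf_le ⟨0, ?_⟩ ?_
    · rintro _ ⟨w, _, rfl⟩; exact (Real.exp_pos _).le
    · rcases eq_or_ne z 0 with rfl | hz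
      · exact ⟨1, by simp, by simp⟩
      · refine ⟨‖z‖⁻¹ • z, ?_, ?_⟩
        · simp [norm_smul, hz]
        · simp only []
          rw [smul_smul, mul_inv_cancel₀ (norm_ne_zero_iff.2 hz), one_smul]
  · intro r hr
    have hne : (sphere (0:ℂ) 1).Nonempty := ⟨1, by simp⟩
    obtain ⟨w, hw, hw2⟩ := hK.exists_sInf_image_eq hne
      (f := fun z : ℂ => Real.exp (u (r • z))) (by fun_prop)
    refine ⟨r • w, ?_, hw2⟩
    have : ‖w‖ = 1 := by simpa using hw
    simp [norm_smul, this, abs_of_nonneg hr]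

theorem aux_len_lower {u : ℂ → ℝ} (hu : Continuous u) {F : ℝ → ℝ} (hF : Continuous F)
    (hFu : ∀ z : ℂ, F ‖z‖ ≤ Real.exp (u z)) (hF0 : ∀ r, 0 ≤ r → 0 ≤ F r)
    {x : ℂ} {γ : ℝ → ℂ} (hγ : γ ∈ PathsIn Set.univ 0 x) :
    ∫ r in (0:ℝ)..‖x‖, F r ≤ confLen u γ := by
  obtain ⟨h0, h1, -, hsm⟩ := hγ
  have hγc : Continuous γ := hsm.continuous
  have hγd : Continuous (deriv γ) := hsm.continuous_deriv (by simp)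
  set φ : ℝ → ℝ := fun t => Real.exp (u (γ t)) * ‖deriv γ t‖ with hφ
  have hφc : Continuous φ := by fun_prop
  set Z : Set ℝ := Set.Icc 0 1 ∩ γ ⁻¹' {0} with hZ
  have hZc : IsCompact Z := isCompact_Icc.inter_right (isClosed_singleton.preimage hγc)
  obtain ⟨a, haZ, hamax⟩ := hZc.exists_isGreatest ⟨0, by simp [hZ, h0]⟩
  have ha0 : 0 ≤ a := haZ.1.1
  have ha1 : a ≤ 1 := haZ.1.2
  have hγa : γ a = 0 := haZ.2
  set Φ : ℝ → ℝ := fun r => ∫ q in (0:ℝ)..r, F q with hΦ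
  have hΦd : ∀ r, HasDerivAt Φ (F r) r := fun r =>
    intervalIntegral.integral_hasDerivAt_right (hF.intervalIntegrable _ _)
      (hF.stronglyMeasurableAtFilter _ _) hF.continuousAt
  have hΦc : Continuous Φ := continuous_iff_continuousAt.2 fun r => (hΦd r).continuousAt
  have hne : ∀ t ∈ Set.Ioo a 1, γ t ≠ 0 := by
    intro t ht h
    have : t ≤ a := hamax ⟨⟨ha0.trans ht.1.le, ht.2.le⟩, h⟩
    linarith [ht.1]
  have hnd : ∀ t ∈ Set.Ioo a 1, DifferentiableAt ℝ (fun t => ‖γ t‖) t := fun t ht =>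
    (hsm.differentiable (by simp) t).norm ℝ (hne t ht)
  have hle : ∀ t ∈ Set.Ioo a 1, deriv (fun t => ‖γ t‖) t ≤ ‖deriv γ t‖ := by
    intro t ht
    have hd1 := (hnd t ht).hasDerivAt.tendsto_slope
    have hd2 := (hsm.differentiable (by simp) t).hasDerivAt.tendsto_slope.norm
    refine le_of_tendsto_of_tendsto hd1 hd2 (Eventually.of_forall fun y => ?_)
    simp only [slope_def_module, norm_smul]
    refine (le_abs_self _).trans ?_
    rw [smul_eq_mul, abs_mul, Real.norm_eq_abs]
    gcongr
    exact abs_norm_sub_norm_le _ _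
  have hmain := intervalIntegral.sub_le_integral_of_hasDeriv_right_of_le
    (g := fun t => Φ ‖γ t‖) (g' := fun t => F ‖γ t‖ * deriv (fun t => ‖γ t‖) t) (φ := φ) ha1
    (by fun_prop)
    (fun t ht => (((hΦd _).comp t (hnd t ht).hasDerivAt)).hasDerivWithinAt)
    hφc.continuousOn.integrableOn_Icc
    (fun t ht => by
      simp only [hφ]
      calc F ‖γ t‖ * deriv (fun t => ‖γ t‖) t ≤ F ‖γ t‖ * ‖deriv γ t‖ :=
            mul_le_mul_of_nonneg_left (hle t ht) (hF0 _ (norm_nonneg _))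
        _ ≤ _ := by gcongr; exact hFu _)
  simp only [h1, hγa, norm_zero] at hmain
  have hΦ0 : Φ 0 = 0 := by simp [hΦ]
  rw [hΦ0, sub_zero] at hmain
  refine hmain.trans ?_
  unfold confLen
  have hsplit := intervalIntegral.integral_add_adjacent_intervals
    (hφc.intervalIntegrable (μ := volume) 0 a) (hφc.intervalIntegrable a 1)
  have hnn : 0 ≤ ∫ t in (0:ℝ)..a, φ t :=
    intervalIntegral.integral_nonneg ha0 fun t _ => by simp only [hφ]; positivity
  linarith

theorem aux_seg (x : ℂ) : (fun t : ℝ => t • x) ∈ PathsIn Set.univ 0 x :=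
  ⟨by simp, by simp, fun _ _ => trivial, contDiff_id.smul contDiff_const⟩

theorem aux_lower {u : ℂ → ℝ} (hu : Continuous u) {x : ℂ} {η κ : ℝ} (hκ : 0 ≤ κ)
    (W : ℝ → ℝ≥0∞)
    (hW : ∀ z : ℂ, ‖z‖ ≤ ‖x‖ → ENNReal.ofReal (Real.exp (-u z - η)) ≤ 1 + W ‖z‖)
    (hWi : ∫⁻ r in Set.Ioc 0 ‖x‖, W r ≤ ENNReal.ofReal κ) :
    ‖x‖ ≤ Real.exp η * confDist u Set.univ 0 x + κ := by
  obtain ⟨F, hF, hFu, hFz⟩ := aux_F hu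
  have hF0 : ∀ r, 0 ≤ r → 0 ≤ F r := by
    intro r hr
    obtain ⟨z, -, h⟩ := hFz r hr
    rw [h]; exact (Real.exp_pos _).le
  have hdist : ∫ r in (0:ℝ)..‖x‖, F r ≤ confDist u Set.univ 0 x := by
    refine le_csInf ⟨_, _, aux_seg x, rfl⟩ ?_
    rintro _ ⟨γ, hγ, rfl⟩
    exact aux_len_lower hu hF hFu hF0 hγ
  have hpt : ∀ r ∈ Set.Ioc 0 ‖x‖, (1:ℝ≥0∞) ≤ ENNReal.ofReal (Real.exp η * F r) + W r := by
    intro r hr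
    obtain ⟨z, hz, hFr⟩ := hFz r hr.1.le
    have h1 := hW z (by rw [hz]; exact hr.2)
    rw [hz] at h1
    set a := Real.exp (-u z - η) with ha
    have ha0 : 0 < a := Real.exp_pos _
    have hb : Real.exp η * F r = a⁻¹ := by
      rw [hFr, ← Real.exp_add, ha, ← Real.exp_neg]; congr 1; ring
    rw [hb]
    have h2 : ENNReal.ofReal 2 ≤ ENNReal.ofReal a + ENNReal.ofReal a⁻¹ := by
      rw [← ENNReal.ofReal_add ha0.le (by positivity)]
      apply ENNReal.ofReal_le_ofReal
      have h3 : a * a⁻¹ = 1 := mul_inv_cancel₀ ha0.ne'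
      have h4 : 0 < a⁻¹ := by positivity
      nlinarith [sq_nonneg (a - 1), sq_nonneg (a - a⁻¹)]
    have h5 : (1:ℝ≥0∞) + 1 ≤ 1 + (ENNReal.ofReal a⁻¹ + W r) := by
      calc (1:ℝ≥0∞) + 1 = ENNReal.ofReal 2 := by
            rw [ENNReal.ofReal_ofNat]; norm_num
        _ ≤ _ := h2
        _ ≤ (1 + W r) + ENNReal.ofReal a⁻¹ := by gcongr
        _ = _ := by ring
    exact (ENNReal.add_le_add_iff_left ENNReal.one_ne_top).1 h5
  have hInt : ENNReal.ofReal ‖x‖ ≤ ENNReal.ofReal (Real.exp η * ∫ r in (0:ℝ)..‖x‖, F r)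
      + ENNReal.ofReal κ := by
    have h1 : ENNReal.ofReal ‖x‖ = ∫⁻ r in Set.Ioc 0 ‖x‖, (1:ℝ≥0∞) := by simp
    rw [h1]
    refine (setLIntegral_mono' measurableSet_Ioc hpt).trans ?_
    rw [lintegral_add_left (by fun_prop)]
    refine add_le_add ?_ hWi
    rw [← intervalIntegral.integral_const_mul, intervalIntegral.integral_of_le (norm_nonneg _),
      ofReal_integral_eq_lintegral_ofReal]
    · exact ((continuous_const.mul hF).integrableOn_Icc).mono_set Set.Ioc_subset_Icc_self
    · rw [EventuallyLE, ae_restrict_iff' measurableSet_Ioc]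
      exact Eventually.of_forall fun r hr =>
        mul_nonneg (Real.exp_pos _).le (hF0 r hr.1.le)
  have hnn : 0 ≤ ∫ r in (0:ℝ)..‖x‖, F r :=
    intervalIntegral.integral_nonneg (norm_nonneg _) fun r hr => hF0 r hr.1
  rw [← ENNReal.ofReal_add (by positivity) hκ, ENNReal.ofReal_le_ofReal_iff (by positivity)] at hInt
  refine hInt.trans ?_
  gcongr

theorem aux_upper {u : ℂ → ℝ} (hu : Continuous u) {x : ℂ} {η κ : ℝ} (hκ : 0 ≤ κ)
    (W : ℝ → ℝ≥0∞)
    (hW : ∀ z : ℂ, ‖z‖ ≤ ‖x‖ → ENNReal.ofReal (Real.exp (u z - η)) ≤ 1 + W ‖z‖)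
    (hWi : ∫⁻ r in Set.Ioc 0 ‖x‖, W r ≤ ENNReal.ofReal κ) :
    confDist u Set.univ 0 x ≤ Real.exp η * (‖x‖ + κ) := by
  have h1 : confDist u Set.univ 0 x ≤ confLen u (fun t : ℝ => t • x) := by
    refine csInf_le ⟨0, ?_⟩ ⟨_, aux_seg x, rfl⟩
    rintro _ ⟨γ, -, rfl⟩
    exact intervalIntegral.integral_nonneg zero_le_one fun t _ => by positivity
  refine h1.trans ?_
  have hder : ∀ t : ℝ, deriv (fun t : ℝ => t • x) t = x := by
    intro t
    have : HasDerivAt (fun t : ℝ => t • x) ((1:ℝ) • x) t := (hasDerivAt_id t).smul_const x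
    simpa using this.deriv
  rcases eq_or_ne x 0 with rfl | hx
  · simp only [confLen, hder]
    simp
    positivity
  have hx' : 0 < ‖x‖ := norm_pos_iff.2 hx
  set e : ℂ := ‖x‖⁻¹ • x with he
  have hen : ‖e‖ = 1 := by simp [he, norm_smul, hx]
  have hlen : confLen u (fun t : ℝ => t • x) = ∫ r in (0:ℝ)..‖x‖, Real.exp (u (r • e)) := by
    simp only [confLen, hder]
    rw [intervalIntegral.integral_mul_const]
    have h2 := intervalIntegral.integral_comp_mul_right (a := 0) (b := 1)
      (fun r => Real.exp (u (r • e))) hx'.ne'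
    have h3 : ∀ t : ℝ, (t * ‖x‖) • e = t • x := by
      intro t
      rw [he, smul_smul, mul_assoc, mul_inv_cancel₀ hx'.ne', mul_one]
    simp only [h3, zero_mul, one_mul, smul_eq_mul] at h2
    rw [h2]; field_simp
  have hc : Continuous (fun r : ℝ => Real.exp (u (r • e) - η)) := by fun_prop
  have hI : ENNReal.ofReal (∫ r in (0:ℝ)..‖x‖, Real.exp (u (r • e) - η))
      ≤ ENNReal.ofReal (‖x‖ + κ) := by
    rw [intervalIntegral.integral_of_le hx'.le]
    refine (aux_ofReal_int _ _).trans ?_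
    have : ∀ r ∈ Set.Ioc 0 ‖x‖, ENNReal.ofReal (Real.exp (u (r • e) - η)) ≤ 1 + W r := by
      intro r hr
      have hn : ‖r • e‖ = r := by simp [norm_smul, hen, abs_of_pos hr.1]
      have := hW (r • e) (by rw [hn]; exact hr.2)
      rwa [hn] at this
    refine (setLIntegral_mono' measurableSet_Ioc this).trans ?_
    rw [lintegral_add_left measurable_const, ENNReal.ofReal_add hx'.le hκ]
    refine add_le_add ?_ hWi
    simp
  rw [ENNReal.ofReal_le_ofReal_iff (by positivity)] at hI
  have hEq : ∫ r in (0:ℝ)..‖x‖, Real.exp (u (r • e))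
      = Real.exp η * ∫ r in (0:ℝ)..‖x‖, Real.exp (u (r • e) - η) := by
    rw [← intervalIntegral.integral_const_mul]
    congr 1; funext r
    rw [← Real.exp_add]; congr 1; ring
  rw [hlen, hEq]
  gcongr

theorem aux_compact {u : ℂ → ℝ} (h : ∀ x : ℂ, x ∉ ball (0:ℂ) 2 → u x = 0) :
    HasCompactSupport u := by
  refine HasCompactSupport.intro (isCompact_closedBall (0:ℂ) 2) ?_
  intro x hx
  exact h x fun hb => hx (ball_subset_closedBall hb)

theorem aux_gauss (u : ℂ → ℝ) (x : ℂ) :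
    max (-gauss u x) 0 * Real.exp (2 * u x) = max (lap u x) 0 := by
  have h1 : Real.exp (-(2 * u x)) * Real.exp (2 * u x) = 1 := by
    rw [← Real.exp_add]; simp
  rw [max_mul_of_nonneg _ _ (Real.exp_pos _).le, zero_mul]
  congr 1
  unfold gauss
  linear_combination lap u x * h1

theorem aux_negmass {u : ℕ → ℂ → ℝ} (hu : ∀ k, ContDiff ℝ (⊤ : ℕ∞) (u k))
    (hK : ∀ φ : ℂ → ℝ, Continuous φ → HasCompactSupport φ →
          Tendsto (fun k => ∫ x in ball (0:ℂ) 1,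
            φ x * (max (-gauss (u k) x) 0 * Real.exp (2 * u k x))) atTop (𝓝 0)) :
    Tendsto (fun k => ∫ x in ball (0:ℂ) 1, max (lap (u k) x) 0) atTop (𝓝 0) := by
  let f : ContDiffBump (0:ℂ) := ⟨1, 2, by norm_num, by norm_num⟩
  have h := hK f f.continuous f.hasCompactSupport
  refine h.congr fun k => ?_
  refine setIntegral_congr_fun measurableSet_ball fun x hx => ?_
  simp only [aux_gauss]
  rw [f.one_of_mem_closedBall (ball_subset_closedBall hx), one_mul]

theorem aux_intOn {h : ℂ → ℝ} (hh : Continuous h) (R : ℝ) : IntegrableOn h (ball (0:ℂ) R) :=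
  (hh.continuousOn.integrableOn_compact (isCompact_closedBall (0:ℂ) R)).mono_set
    ball_subset_closedBall

theorem aux_lint {h : ℂ → ℝ} (hh : Continuous h) (R : ℝ) :
    ∫⁻ x in ball (0:ℂ) R, ENNReal.ofReal (h x)
      = ENNReal.ofReal (∫ x in ball (0:ℂ) R, max (h x) 0) := by
  rw [ofReal_integral_eq_lintegral_ofReal (aux_intOn (h := fun x => max (h x) 0) (hh.max continuous_const) R)
    (Eventually.of_forall fun x => le_max_right _ _)]
  simp

theorem aux_posmass {u : ℕ → ℂ → ℝ} (hu : ∀ k, ContDiff ℝ (⊤ : ℕ∞) (u k))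
    (hu2 : ∀ k, ∀ x : ℂ, x ∉ ball (0:ℂ) 2 → u k x = 0)
    (hw : ∀ φ : ℂ → ℝ, ContDiff ℝ (⊤ : ℕ∞) φ → HasCompactSupport φ →
      tsupport φ ⊆ ball (0:ℂ) 2 →
      Tendsto (fun k => ∫ x in ball (0:ℂ) 2, u k x * φ x) atTop (𝓝 0))
    (hneg : Tendsto (fun k => ∫ x in ball (0:ℂ) 1, max (lap (u k) x) 0) atTop (𝓝 0))
    {R : ℝ} (hR0 : 0 < R) (hR : R < 1) :
    Tendsto (fun k => ∫ x in ball (0:ℂ) R, max (-lap (u k) x) 0) atTop (𝓝 0) := by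
  let f : ContDiffBump (0:ℂ) := ⟨R, 1, hR0, hR⟩
  have hf : ContDiff ℝ (⊤ : ℕ∞) f := f.contDiff
  have hfc : HasCompactSupport f := f.hasCompactSupport
  have hts : tsupport f ⊆ ball (0:ℂ) 2 := by
    rw [f.tsupport_eq]; exact closedBall_subset_ball (by norm_num [f])
  have hl := hw (lap f) (aux_lap_smooth hf)
    (hfc.of_isClosed_subset (isClosed_tsupport _) (aux_lap_supp hf))
    ((aux_lap_supp hf).trans hts)
  have hlim : Tendsto (fun k => -(∫ x in ball (0:ℂ) 2, u k x * lap f x)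
      + ∫ x in ball (0:ℂ) 1, max (lap (u k) x) 0) atTop (𝓝 0) := by
    simpa using hl.neg.add hneg
  refine squeeze_zero (fun k => integral_nonneg fun x => le_max_right _ _) (fun k => ?_) hlim
  have hlc := (aux_lap_smooth (hu k)).continuous
  have h1 : ∫ x in ball (0:ℂ) 2, u k x * lap f x = ∫ x, f x * lap (u k) x := by
    rw [aux_green hf (hu k) hfc]
    rw [setIntegral_eq_integral_of_forall_compl_eq_zero]
    · congr 1; funext x; ring
    · intro x hx; simp [hu2 k x hx]
  have hi : ∀ h : ℂ → ℝ, Continuous h → Integrable (fun x => f x * h x) := fun h hh =>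
    (f.continuous.mul hh).integrable_of_hasCompactSupport hfc.mul_right
  have hp : Continuous fun x => max (lap (u k) x) 0 := hlc.max continuous_const
  have hn : Continuous fun x => max (-lap (u k) x) 0 := hlc.neg.max continuous_const
  have h2 : ∫ x, f x * max (-lap (u k) x) 0
      = -(∫ x, f x * lap (u k) x) + ∫ x, f x * max (lap (u k) x) 0 := by
    rw [← integral_neg, ← integral_add (f := fun x => -(f x * lap (u k) x)) (hi _ hlc).neg
      (hi _ hp)]
    congr 1; funext x
    rcases le_total (lap (u k) x) 0 with h | h
    · rw [max_eq_left (by linarith), max_eq_right h]; ring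
    · rw [max_eq_right (by linarith), max_eq_left h]; ring
  have h3 : ∫ x, f x * max (lap (u k) x) 0 ≤ ∫ x in ball (0:ℂ) 1, max (lap (u k) x) 0 := by
    rw [← setIntegral_eq_integral_of_forall_compl_eq_zero (s := ball (0:ℂ) 1)]
    · refine setIntegral_mono (hi _ hp).integrableOn (aux_intOn hp 1) fun x => ?_
      have : f x ≤ 1 := f.le_one
      have h0 : 0 ≤ max (lap (u k) x) 0 := le_max_right _ _
      simp only []
      nlinarith
    · intro x hx
      rw [f.zero_of_le_dist (by simpa [f] using hx)]; simp
  have h4 : ∫ x in ball (0:ℂ) R, max (-lap (u k) x) 0 ≤ ∫ x, f x * max (-lap (u k) x) 0 := by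
    have h5 : ∫ x in ball (0:ℂ) R, max (-lap (u k) x) 0
        = ∫ x in ball (0:ℂ) R, f x * max (-lap (u k) x) 0 := by
      refine setIntegral_congr_fun measurableSet_ball fun x hx => ?_
      rw [f.one_of_mem_closedBall (ball_subset_closedBall hx), one_mul]
    rw [h5]
    exact setIntegral_le_integral (hi _ hn) (Eventually.of_forall fun x =>
      mul_nonneg f.nonneg (le_max_right _ _))
  rw [h1]
  linarith

theorem aux_L1 {u : ℂ → ℝ} (hu : Continuous u) {C X : ℝ} (hX : 0 ≤ X)
    (h : (∫ x in ball (0:ℂ) 2, |u x| ^ (3/2 : ℝ)) ^ (1/(3/2) : ℝ) + X ≤ C) :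
    ∫ x in ball (0:ℂ) 2, |u x| ≤ volume.real (ball (0:ℂ) 2) + C ^ (3/2 : ℝ) := by
  have hpc : Continuous fun x => |u x| ^ (3/2 : ℝ) :=
    hu.abs.rpow_const fun x => Or.inr (by norm_num)
  set A := ∫ x in ball (0:ℂ) 2, |u x| ^ (3/2 : ℝ) with hA
  have hA0 : 0 ≤ A := integral_nonneg fun x => by positivity
  have hAC : A ≤ C ^ (3/2 : ℝ) := by
    have h1 : A ^ (1/(3/2) : ℝ) ≤ C := by linarith
    have h2 := Real.rpow_le_rpow (by positivity) h1 (by norm_num : (0:ℝ) ≤ 3/2)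
    rw [← Real.rpow_mul hA0] at h2
    norm_num at h2
    convert h2 using 2
  have h3 : ∫ x in ball (0:ℂ) 2, |u x| ≤ ∫ x in ball (0:ℂ) 2, (1 + |u x| ^ (3/2 : ℝ)) := by
    refine setIntegral_mono (aux_intOn hu.abs 2) (aux_intOn (continuous_const.add hpc) 2) ?_
    intro x
    simp only []
    rcases le_total |u x| 1 with h | h
    · have : 0 ≤ |u x| ^ (3/2 : ℝ) := by positivity
      linarith
    · have := Real.self_le_rpow_of_one_le h (by norm_num : (1:ℝ) ≤ 3/2)
      linarith
  refine h3.trans ?_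
  rw [integral_add (aux_intOn continuous_const 2) (aux_intOn hpc 2)]
  simp only [setIntegral_const, smul_eq_mul, mul_one]
  gcongr

theorem aux_avg {ψ : ℂ → ℝ} (hψ : ContDiff ℝ (⊤ : ℕ∞) ψ) (hψc : HasCompactSupport ψ)
    (hψs : ∀ z, 1 < ‖z‖ → ψ z = 0)
    {u : ℕ → ℂ → ℝ} (hu : ∀ k, ContDiff ℝ (⊤ : ℕ∞) (u k))
    (hu2 : ∀ k, ∀ x : ℂ, x ∉ ball (0:ℂ) 2 → u k x = 0)
    (hw : ∀ φ : ℂ → ℝ, ContDiff ℝ (⊤ : ℕ∞) φ → HasCompactSupport φ →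
      tsupport φ ⊆ ball (0:ℂ) 2 →
      Tendsto (fun k => ∫ x in ball (0:ℂ) 2, u k x * φ x) atTop (𝓝 0))
    {Λ : ℝ} (hΛ : ∀ k, ∫ x in ball (0:ℂ) 2, |u k x| ≤ Λ)
    {s δ η : ℝ} (hδ : 0 < δ) (hsδ : s + δ < 2) (hη : 0 < η) :
    ∀ᶠ k in atTop, ∀ x : ℂ, ‖x‖ ≤ s → |∫ z, ψ z * u k (x + δ • z)| ≤ η := by
  set T : ℕ → ℂ → ℝ := fun k x => ∫ y in ball (0:ℂ) 2, u k y * ψ (δ⁻¹ • (y - x)) with hT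
  have hΛ0 : 0 ≤ Λ := le_trans (integral_nonneg fun x => abs_nonneg _) (hΛ 0)
  have hconv : ∀ k x, ∫ z, ψ z * u k (x + δ • z) = (δ ^ 2)⁻¹ * T k x := by
    intro k x
    have h1 := Measure.integral_comp_smul (volume : Measure ℂ)
      (fun w => u k (x + w) * ψ (δ⁻¹ • ((x + w) - x))) δ
    have h2 : ∀ z : ℂ, δ⁻¹ • ((x + δ • z) - x) = z := by
      intro z; rw [add_sub_cancel_left, smul_smul, inv_mul_cancel₀ hδ.ne', one_smul]
    simp only [h2] at h1
    rw [integral_add_left_eq_self (fun w => u k w * ψ (δ⁻¹ • (w - x))) x] at h1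
    simp only [hT]
    rw [setIntegral_eq_integral_of_forall_compl_eq_zero]
    · simp only [mul_comm (ψ _)]
      rw [h1, Complex.finrank_real_complex, smul_eq_mul, abs_of_pos (by positivity)]
    · intro y hy; simp [hu2 k y hy]
  have hpt : ∀ x : ℂ, ‖x‖ ≤ s → Tendsto (fun k => T k x) atTop (𝓝 0) := by
    intro x hx
    have hsupp : ∀ y : ℂ, y ∉ closedBall x δ → ψ (δ⁻¹ • (y - x)) = 0 := by
      intro y hy
      apply hψs
      simp only [mem_closedBall, not_le, dist_eq_norm] at hy
      rw [norm_smul, Real.norm_eq_abs, abs_of_pos (by positivity), inv_mul_eq_div,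
        one_lt_div hδ]
      exact hy
    refine hw (fun y => ψ (δ⁻¹ • (y - x))) ?_ ?_ ?_
    · exact hψ.comp ((contDiff_id.sub contDiff_const).const_smul _)
    · exact HasCompactSupport.intro (isCompact_closedBall x δ) hsupp
    · have h1 : tsupport (fun y => ψ (δ⁻¹ • (y - x))) ⊆ closedBall x δ := by
        refine closure_minimal ?_ isClosed_closedBall
        intro y hy
        by_contra h
        exact hy (hsupp y h)
      refine h1.trans fun y hy => ?_
      have hd : ‖y - x‖ ≤ δ := by simpa [dist_eq_norm] using hy
      have := norm_le_norm_add_norm_sub' y x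
      simp only [mem_ball, dist_zero_right]; linarith
  have huc : UniformContinuous ψ := hψc.uniformContinuous_of_continuous hψ.continuous
  set ε := δ ^ 2 * η / 2 / (Λ + 1) with hε
  have hε0 : 0 < ε := by positivity
  obtain ⟨d, hd, hdψ⟩ := Metric.uniformContinuous_iff.1 huc ε hε0
  have hlip : ∀ k x x', dist x x' < δ * d → |T k x - T k x'| ≤ ε * Λ := by
    intro k x x' hxx
    have hc : ∀ x : ℂ, Continuous (fun y => u k y * ψ (δ⁻¹ • (y - x))) := fun x => by
      have h1 := (hu k).continuous
      have h2 := hψ.continuous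
      fun_prop
    simp only [hT]
    rw [← integral_sub (aux_intOn (hc x) 2) (aux_intOn (hc x') 2)]
    calc |∫ y in ball (0:ℂ) 2, (u k y * ψ (δ⁻¹ • (y - x)) - u k y * ψ (δ⁻¹ • (y - x')))|
        ≤ ∫ y in ball (0:ℂ) 2, |u k y * ψ (δ⁻¹ • (y - x)) - u k y * ψ (δ⁻¹ • (y - x'))| :=
          abs_integral_le_integral_abs
      _ ≤ ∫ y in ball (0:ℂ) 2, ε * |u k y| := by
          refine setIntegral_mono (aux_intOn ((hc x).sub (hc x')).abs 2)
            (aux_intOn (continuous_const.mul (hu k).continuous.abs) 2) fun y => ?_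
          simp only []
          rw [← mul_sub, abs_mul, mul_comm]
          gcongr
          have h1 : dist (δ⁻¹ • (y - x)) (δ⁻¹ • (y - x')) < d := by
            rw [dist_smul₀, Real.norm_eq_abs, abs_of_pos (by positivity), dist_sub_left,
              inv_mul_lt_iff₀ hδ]
            exact hxx
          have := hdψ h1
          rw [Real.dist_eq] at this
          exact this.le
      _ = ε * ∫ y in ball (0:ℂ) 2, |u k y| := integral_const_mul _ _
      _ ≤ ε * Λ := by gcongr; exact hΛ k
  obtain ⟨t, hts, htf, htc⟩ := (isCompact_closedBall (0:ℂ) s).finite_cover_balls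
    (e := δ * d) (by positivity)
  have hev : ∀ᶠ k in atTop, ∀ x ∈ t, |T k x| < δ ^ 2 * η / 2 := by
    rw [Filter.eventually_all_finite htf]
    intro x hx
    have h1 := hpt x (by simpa using hts hx)
    have h2 := (Metric.tendsto_nhds.1 h1) (δ ^ 2 * η / 2) (by positivity)
    simpa [Real.dist_eq] using h2
  filter_upwards [hev] with k hk x hx
  obtain ⟨x', hx', hxx'⟩ := Set.mem_iUnion₂.1 (htc (by simpa using hx))
  have h1 := hlip k x x' hxx'
  have h2 := hk x' hx'
  have h3 : ε * Λ ≤ δ ^ 2 * η / 2 := by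
    have : ε * (Λ + 1) = δ ^ 2 * η / 2 := by rw [hε]; field_simp
    nlinarith
  have h4 : |T k x| ≤ δ ^ 2 * η := by
    have := abs_sub_abs_le_abs_sub (T k x) (T k x')
    linarith
  rw [hconv, abs_mul, abs_of_pos (by positivity : 0 < (δ ^ 2)⁻¹), inv_mul_le_iff₀ (by positivity)]
  exact h4

theorem aux_side {ψ P : ℂ → ℝ} {C B : ℝ} (hC : 0 < C) (hψ : ContDiff ℝ (⊤ : ℕ∞) ψ)
    (hψc : HasCompactSupport ψ) (hP : ContDiff ℝ (⊤ : ℕ∞) P)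
    (hPc : HasCompactSupport P) (hP0 : ∀ z, 0 ≤ P z) (hPC : ∀ z, P z ≤ C)
    (hPs : ∀ z, 1 < ‖z‖ → P z = 0)
    (hfd : ∀ z w, fderiv ℝ P z w = -ψ z * dotC z w) (hmass : ∫ z, ψ z = 1)
    (hB0 : 0 ≤ B)
    (hB : ∀ ρ s : ℝ, 0 ≤ ρ → ρ ≤ 1 → s ≤ 1 →
      ∫⁻ r in Set.Ioc 0 s, ENNReal.ofReal (1 + |ρ - r| ^ (-(1/2):ℝ)) ≤ ENNReal.ofReal B)
    {u : ℂ → ℝ} (hu : ContDiff ℝ (⊤ : ℕ∞) u) (huc : HasCompactSupport u)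
    {s δ R η κ m : ℝ} (hδ : 0 < δ) (hδ1 : δ ≤ 1) (hs : s + δ < R) (hR : R < 1)
    (hη : ∀ x : ℂ, ‖x‖ ≤ s → ∫ z, ψ z * u (x + δ • z) ≤ η)
    (hm0 : 0 ≤ m)
    (hm : ∫⁻ y in ball (0:ℂ) R, ENNReal.ofReal (-lap u y) ≤ ENNReal.ofReal m)
    (hm1 : 2 * C * m ≤ 1) (hm2 : 2 * C * (B * m) ≤ κ) :
    ∃ W : ℝ → ℝ≥0∞, (∀ z : ℂ, ‖z‖ ≤ s →
        ENNReal.ofReal (Real.exp (u z - η)) ≤ 1 + W ‖z‖) ∧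
      ∫⁻ r in Set.Ioc 0 s, W r ≤ ENNReal.ofReal κ := by
  refine ⟨fun r => ENNReal.ofReal (2 * C) * ∫⁻ y in ball (0:ℂ) R,
    ENNReal.ofReal (-lap u y) * ENNReal.ofReal (1 + |‖y‖ - r| ^ (-(1/2) : ℝ)), ?_, ?_⟩
  · intro z hz
    refine aux_point hC hψ hψc hP hPc hP0 hPC hPs hfd hmass hu huc hδ hδ1 (by linarith)
      (hη z hz) ?_
    calc _ ≤ ENNReal.ofReal (2 * C) * ENNReal.ofReal m := by gcongr
      _ = ENNReal.ofReal (2 * C * m) := (ENNReal.ofReal_mul (by positivity)).symm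
      _ ≤ 1 := by rw [← ENNReal.ofReal_one]; exact ENNReal.ofReal_le_ofReal hm1
  · have hcont : Continuous fun y => -lap u y := (aux_lap_smooth hu).continuous.neg
    refine (aux_integrated hcont (by positivity) hB (by linarith) hR.le).trans ?_
    calc _ ≤ ENNReal.ofReal (2 * C) * (ENNReal.ofReal B * ENNReal.ofReal m) := by gcongr
      _ = ENNReal.ofReal (2 * C * (B * m)) := by
        rw [← ENNReal.ofReal_mul hB0, ← ENNReal.ofReal_mul (by positivity)]
      _ ≤ _ := ENNReal.ofReal_le_ofReal hm2

theorem aux_main (u : ℕ → ℂ → ℝ)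
    (hu : ∀ k, ContDiff ℝ (⊤ : ℕ∞) (u k))
    (hu2 : ∀ k, ∀ x : ℂ, x ∉ ball (0:ℂ) 2 → u k x = 0)
    (hW : WeakW1pLim (ball (0:ℂ) 2) (3/2) u (fun _ => 0))
    (hK : ∀ φ : ℂ → ℝ, Continuous φ → HasCompactSupport φ →
          Tendsto (fun k => ∫ x in ball (0:ℂ) 1,
            φ x * (max (-gauss (u k) x) 0 * Real.exp (2 * u k x))) atTop (𝓝 0))
    {x : ℂ} (hx : ‖x‖ < 1) {η : ℝ} (hη : 0 < η) :
    ∀ᶠ k in atTop, confDist (u k) Set.univ 0 x ≤ Real.exp η * (‖x‖ + η) ∧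
      ‖x‖ ≤ Real.exp η * confDist (u k) Set.univ 0 x + η := by
  obtain ⟨ψ, P, C, hC, hψ, hψc, hψs, hP, hPc, hP0, hPC, hPs, hfd, hmass⟩ := aux_bump
  obtain ⟨B, hB0, hB⟩ := aux_B
  obtain ⟨V, -, ⟨C', hC'⟩, hlim⟩ := hW
  have hw : ∀ φ : ℂ → ℝ, ContDiff ℝ (⊤ : ℕ∞) φ → HasCompactSupport φ →
      tsupport φ ⊆ ball (0:ℂ) 2 →
      Tendsto (fun k => ∫ x in ball (0:ℂ) 2, u k x * φ x) atTop (𝓝 0) := by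
    intro φ h1 h2 h3
    simpa using (hlim φ h1 h2 h3).1
  have hΛ : ∀ k, ∫ x in ball (0:ℂ) 2, |u k x| ≤ volume.real (ball (0:ℂ) 2) + C' ^ (3/2:ℝ) :=
    fun k => aux_L1 (hu k).continuous (by positivity) (hC' k)
  have hneg := aux_negmass hu hK
  set δ : ℝ := (1 - ‖x‖) / 3 with hδd
  have hn := norm_nonneg x
  have hδ : 0 < δ := by rw [hδd]; linarith
  have hδ1 : δ ≤ 1 := by rw [hδd]; linarith
  set R : ℝ := ‖x‖ + 2 * δ with hRd
  have hR : R < 1 := by rw [hRd, hδd]; linarith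
  have hpos := aux_posmass hu hu2 hw hneg (R := R) (by linarith) hR
  have havg := aux_avg hψ hψc hψs hu hu2 hw hΛ (s := ‖x‖) hδ (by linarith) hη
  obtain ⟨m, hm, hm1, hm2⟩ : ∃ m : ℝ, 0 < m ∧ 2 * C * m ≤ 1 ∧ 2 * C * (B * m) ≤ η := by
    refine ⟨min (1 / (2 * C)) (η / (2 * C * (B + 1))), by positivity, ?_, ?_⟩
    · calc _ ≤ 2 * C * (1 / (2 * C)) := by gcongr; exact min_le_left _ _
        _ = 1 := by field_simp
    · calc _ ≤ 2 * C * ((B + 1) * (η / (2 * C * (B + 1)))) := by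
            gcongr
            · linarith
            · exact min_le_right _ _
        _ = η := by field_simp
  filter_upwards [havg, hpos.eventually_lt_const hm, hneg.eventually_lt_const hm]
    with k hk1 hk2 hk3
  have hlc := (aux_lap_smooth (hu k)).continuous
  have huc := aux_compact (hu2 k)
  have hs : ‖x‖ + δ < R := by linarith
  constructor
  · obtain ⟨W, h1, h2⟩ := aux_side hC hψ hψc hP hPc hP0 hPC hPs hfd hmass hB0 hB (hu k) huc
      (η := η) (κ := η) (m := m) hδ hδ1 hs hR (fun z hz => (abs_le.1 (hk1 z hz)).2) hm.le
      (by rw [aux_lint (h := fun y => -lap (u k) y) hlc.neg]; exact ENNReal.ofReal_le_ofReal hk2.le) hm1 hm2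
    exact aux_upper (hu k).continuous hη.le W h1 h2
  · obtain ⟨W, h1, h2⟩ := aux_side hC hψ hψc hP hPc hP0 hPC hPs hfd hmass hB0 hB
      (u := fun y => - u k y) (hu k).neg huc.neg
      (η := η) (κ := η) (m := m) hδ hδ1 hs hR (fun z hz => by
        simp only [mul_neg, integral_neg]
        linarith [(abs_le.1 (hk1 z hz)).1]) hm.le
      (by
        simp only [aux_lap_neg, neg_neg]
        refine (lintegral_mono_set (ball_subset_ball hR.le)).trans ?_
        rw [aux_lint hlc]; exact ENNReal.ofReal_le_ofReal hk3.le) hm1 hm2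
    exact aux_lower (hu k).continuous hη.le W h1 h2

theorem aux_final (u : ℕ → ℂ → ℝ) (d₀ : ℂ → ℂ → ℝ)
    (hu : ∀ k, ContDiff ℝ (⊤ : ℕ∞) (u k))
    (hu2 : ∀ k, ∀ x : ℂ, x ∉ ball (0:ℂ) 2 → u k x = 0)
    (hW : WeakW1pLim (ball (0:ℂ) 2) (3/2) u (fun _ => 0))
    (hK : ∀ φ : ℂ → ℝ, Continuous φ → HasCompactSupport φ →
          Tendsto (fun k => ∫ x in ball (0:ℂ) 1,
            φ x * (max (-gauss (u k) x) 0 * Real.exp (2 * u k x))) atTop (𝓝 0))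
    (hd : ∀ ε : ℝ, 0 < ε → ∀ᶠ k in atTop, ∀ x ∈ ball (0:ℂ) 1, ∀ y ∈ ball (0:ℂ) 1,
          |confDist (u k) Set.univ x y - d₀ x y| < ε)
    (x : ℂ) (hx : x ∈ ball (0:ℂ) 1) : d₀ 0 x = ‖x‖ := by
  have hx1 : ‖x‖ < 1 := by simpa using hx
  have key : ∀ η : ℝ, 0 < η → d₀ 0 x - η ≤ Real.exp η * (‖x‖ + η) ∧
      ‖x‖ ≤ Real.exp η * (d₀ 0 x + η) + η := by
    intro η hη
    obtain ⟨k, hk, hk2⟩ := ((aux_main u hu hu2 hW hK hx1 hη).and (hd η hη)).exists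
    have h := abs_lt.1 (hk2 0 (by simp) x hx)
    refine ⟨by linarith [hk.1], hk.2.trans ?_⟩
    gcongr
    linarith
  apply le_antisymm
  · have t1 : Tendsto (fun η : ℝ => d₀ 0 x - η) (𝓝[>] 0) (𝓝 (d₀ 0 x)) := by
      have : Continuous fun η : ℝ => d₀ 0 x - η := by fun_prop
      simpa using (this.tendsto 0).mono_left nhdsWithin_le_nhds
    have t2 : Tendsto (fun η : ℝ => Real.exp η * (‖x‖ + η)) (𝓝[>] 0) (𝓝 ‖x‖) := by
      have : Continuous fun η : ℝ => Real.exp η * (‖x‖ + η) := by fun_prop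
      simpa using (this.tendsto 0).mono_left nhdsWithin_le_nhds
    refine le_of_tendsto_of_tendsto t1 t2 ?_
    filter_upwards [self_mem_nhdsWithin] with η hη
    exact (key η hη).1
  · have t2 : Tendsto (fun η : ℝ => Real.exp η * (d₀ 0 x + η) + η) (𝓝[>] 0) (𝓝 (d₀ 0 x)) := by
      have : Continuous fun η : ℝ => Real.exp η * (d₀ 0 x + η) + η := by fun_prop
      simpa using (this.tendsto 0).mono_left nhdsWithin_le_nhds
    refine ge_of_tendsto t2 ?_
    filter_upwards [self_mem_nhdsWithin] with η hη
    exact (key η hη).2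

/-- if `u_k ⇀ 0` weakly in `W^{1,p}(D₂)`, the metrics have small total
curvature, the negative curvature measures converge weakly to `0`, and the distances
converge uniformly to `d₀`, then `d₀(0, ·)` is the Euclidean distance on `D`. -/
theorem statement13 :
    ∃ ε₀ : ℝ, 0 < ε₀ ∧
      ∀ (u : ℕ → ℂ → ℝ) (d₀ : ℂ → ℂ → ℝ),
        (∀ k, ContDiff ℝ (⊤ : ℕ∞) (u k)) →
        (∀ k, ∀ x : ℂ, x ∉ ball (0:ℂ) 2 → u k x = 0) →
        (∀ p : ℝ, 1 < p → p < 2 → WeakW1pLim (ball (0:ℂ) 2) p u (fun _ => 0)) →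
        (∀ k, curvIntE (u k) (ball (0:ℂ) 1) < ENNReal.ofReal ε₀) →
        -- `K⁻(g_k) dμ_{g_k} ⇀ 0`
        (∀ φ : ℂ → ℝ, Continuous φ → HasCompactSupport φ →
          Tendsto (fun k => ∫ x in ball (0:ℂ) 1,
            φ x * (max (-gauss (u k) x) 0 * Real.exp (2 * u k x))) atTop (𝓝 0)) →
        -- `d_{g_k} → d₀` uniformly on `D × D`
        (∀ ε : ℝ, 0 < ε → ∀ᶠ k in atTop, ∀ x ∈ ball (0:ℂ) 1, ∀ y ∈ ball (0:ℂ) 1,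
          |confDist (u k) Set.univ x y - d₀ x y| < ε) →
        ∀ x ∈ ball (0:ℂ) 1, d₀ 0 x = ‖x‖ := by
  exact ⟨1, one_pos, fun u d₀ hu hu2 hW _ hK hd x hx =>
    aux_final u d₀ hu hu2 (hW (3/2) (by norm_num) (by norm_num)) hK hd x hx⟩
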